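/- Let β > 0 and define F : (0,∞)² → ℝ by F(a, p) = (1/π)·(√(a − p) + √p · arcsin √(p/a)) if a > p and F(a, p) = (1/2)·√p if a ≤ p. Then ∫₀^∞ ∫₀^∞ (β^{3/2}/√(π·p))·e^{−β(a + p)}·F(a, p) da dp = 1/√(2πβ). -/

import Mathlib

open MeasureTheory Real

noncomputable def ff (t : ℝ) : ℝ :=
  if 1 < t then (1/Real.pi) * (Real.sqrt (t - 1) + Real.arcsin (Real.sqrt (1/t))) else 1/2

noncomputable def hh (u : ℝ) : ℝ :=
  -((1/Real.pi) * (u + (Real.pi/2 - Real.arctan u))) / (2 + u^2)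
    + (1/Real.pi) * (-Real.arctan u + Real.sqrt 2 * Real.arctan (u / Real.sqrt 2))

lemma ff_meas : Measurable ff := by
  unfold ff
  refine Measurable.ite measurableSet_Ioi ?_ measurable_const
  have := Real.measurable_arcsin
  fun_prop

lemma ff_nonneg (t : ℝ) : 0 ≤ ff t := by
  unfold ff
  split_ifs
  · have : 0 ≤ Real.arcsin (Real.sqrt (1/t)) := Real.arcsin_nonneg.2 (Real.sqrt_nonneg _)
    positivity
  · norm_num

lemma ff_eq (t : ℝ) (ht : 1 < t) :
    ff t = (1/Real.pi) * (Real.sqrt (t-1) + (Real.pi/2 - Real.arctan (Real.sqrt (t-1)))) := by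
  have h0 : 0 < t := by linarith
  have h1 : 0 < Real.sqrt (t-1) := Real.sqrt_pos.2 (by linarith)
  unfold ff
  rw [if_pos ht, ← Real.arctan_inv_of_pos h1, Real.arcsin_eq_arctan]
  · congr 3
    rw [Real.sq_sqrt (by positivity), ← Real.sqrt_div (by positivity), ← Real.sqrt_inv]
    congr 1
    have : t - 1 ≠ 0 := by linarith
    field_simp
  · constructor
    · have := Real.sqrt_nonneg (1/t)
      linarith
    · rw [Real.sqrt_lt' one_pos, div_lt_iff₀ h0]
      linarith

lemma hh_deriv (u : ℝ) :
    HasDerivAt hh (2*u*((1/Real.pi) * (u + (Real.pi/2 - Real.arctan u)))/(2+u^2)^2) u := by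
  unfold hh
  have hp : Real.pi ≠ 0 := Real.pi_ne_zero
  have h2 : (2 + u^2) ≠ 0 := by positivity
  have hs : Real.sqrt 2 ≠ 0 := by positivity
  have hss : Real.sqrt 2 ^ 2 = 2 := Real.sq_sqrt (by norm_num)
  have hi := hasDerivAt_id' u
  have ha := Real.hasDerivAt_arctan u
  have ha2 := (hi.div_const (Real.sqrt 2)).arctan
  have hn := (((hi.add (ha.const_sub (Real.pi/2))).const_mul (1/Real.pi)).neg).div
    ((hi.pow 2).const_add 2) h2
  have hm := (ha.neg.add (ha2.const_mul (Real.sqrt 2))).const_mul (1/Real.pi)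
  refine (hn.add hm).congr_deriv ?_
  have h3 : (1 + u^2) ≠ 0 := by positivity
  have e : Real.sqrt 2 * (1 / (1 + (u / Real.sqrt 2)^2) * (1 / Real.sqrt 2)) = 2 / (2 + u^2) := by
    rw [div_pow, hss]; field_simp
  rw [e]
  simp
  field_simp
  ring

lemma hh_tendsto : Filter.Tendsto hh Filter.atTop (nhds ((Real.sqrt 2 - 1)/2)) := by
  have hs : 0 < Real.sqrt 2 := by positivity
  have hat : Filter.Tendsto Real.arctan Filter.atTop (nhds (Real.pi/2)) :=
    Real.tendsto_arctan_atTop.mono_right nhdsWithin_le_nhds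
  have hat2 := hat.comp (Filter.tendsto_id.atTop_div_const hs)
  have hd : Filter.Tendsto (fun u : ℝ => 2 + u^2) Filter.atTop Filter.atTop :=
    Filter.tendsto_atTop_add_const_left _ _ (Filter.tendsto_pow_atTop two_ne_zero)
  have h1 : Filter.Tendsto (fun u : ℝ => u/(2+u^2)) Filter.atTop (nhds 0) := by
    refine squeeze_zero' ?_ ?_ tendsto_inv_atTop_zero
    · filter_upwards [Filter.eventually_gt_atTop 0] with u hu
      positivity
    · filter_upwards [Filter.eventually_gt_atTop 0] with u hu
      rw [div_le_iff₀ (by positivity)]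
      field_simp
      nlinarith
  have h2 : Filter.Tendsto (fun u : ℝ => (Real.pi/2 - Real.arctan u)/(2+u^2)) Filter.atTop (nhds 0) :=
    (hat.const_sub (Real.pi/2)).div_atTop hd
  have h3 := ((h1.add h2).const_mul (-(1/Real.pi))).add
    ((hat.neg.add (hat2.const_mul (Real.sqrt 2))).const_mul (1/Real.pi))
  have e : -(1 / Real.pi) * (0 + 0) + 1 / Real.pi * (-(Real.pi / 2) + Real.sqrt 2 * (Real.pi / 2))
      = (Real.sqrt 2 - 1)/2 := by
    field_simp
    ring
  rw [e] at h3
  refine h3.congr ?_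
  intro u
  simp [hh]
  ring

lemma int_big : IntegrableOn (fun t => ff t / (1+t)^2) (Set.Ioi 1) ∧
    ∫ t in Set.Ioi (1:ℝ), ff t / (1+t)^2 = (Real.sqrt 2 - 1)/2 + 1/4 := by
  have hc : Continuous hh := continuous_iff_continuousAt.2 fun u => (hh_deriv u).continuousAt
  have c1 : ContinuousWithinAt (fun t => hh (Real.sqrt (t-1))) (Set.Ici 1) 1 := by
    apply Continuous.continuousWithinAt
    fun_prop
  have d1 : ∀ t ∈ Set.Ioi (1:ℝ), HasDerivAt (fun t => hh (Real.sqrt (t-1))) (ff t / (1+t)^2) t := by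
    intro t ht
    have ht : 1 < t := ht
    have hu : 0 < Real.sqrt (t-1) := Real.sqrt_pos.2 (by linarith)
    have hsq : Real.sqrt (t-1)^2 = t-1 := Real.sq_sqrt (by linarith)
    have := (hh_deriv (Real.sqrt (t-1))).comp t
      (((hasDerivAt_id' t).sub_const 1).sqrt (by linarith))
    refine this.congr_deriv ?_
    rw [← ff_eq t ht, hsq]
    have : 1 + t ≠ 0 := by linarith
    have e : 2 + (t-1) = 1 + t := by ring
    rw [e]
    field_simp
  have n1 : ∀ t ∈ Set.Ioi (1:ℝ), 0 ≤ ff t / (1+t)^2 := fun t _ =>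
    div_nonneg (ff_nonneg t) (sq_nonneg _)
  have t1 : Filter.Tendsto (fun t => hh (Real.sqrt (t-1))) Filter.atTop
      (nhds ((Real.sqrt 2 - 1)/2)) :=
    hh_tendsto.comp (Real.tendsto_sqrt_atTop.comp
      (Filter.tendsto_atTop_add_const_right _ (-1) Filter.tendsto_id))
  refine ⟨integrableOn_Ioi_deriv_of_nonneg c1 d1 n1 t1, ?_⟩
  rw [integral_Ioi_of_hasDerivAt_of_nonneg c1 d1 n1 t1]
  have : hh (Real.sqrt (1-1)) = -1/4 := by
    simp [hh]
    field_simp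
    norm_num
  rw [this]; ring

lemma int_small : IntegrableOn (fun t => ff t / (1+t)^2) (Set.Ioc 0 1) ∧
    ∫ t in Set.Ioc (0:ℝ) 1, ff t / (1+t)^2 = 1/4 := by
  have e : Set.EqOn (fun t => ff t / (1+t)^2) (fun t => (1/2) / (1+t)^2) (Set.Ioc 0 1) := by
    intro t ht
    simp only [ff, if_neg (not_lt.2 ht.2)]
  have hint : IntervalIntegrable (fun t : ℝ => (1/2) / (1+t)^2) volume 0 1 := by
    apply ContinuousOn.intervalIntegrable
    rw [Set.uIcc_of_le zero_le_one]
    apply ContinuousOn.div (by fun_prop) (by fun_prop)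
    intro t ht
    have := ht.1
    positivity
  constructor
  · rw [integrableOn_congr_fun e measurableSet_Ioc]
    exact (intervalIntegrable_iff_integrableOn_Ioc_of_le zero_le_one).1 hint
  · rw [setIntegral_congr_fun measurableSet_Ioc e, ← intervalIntegral.integral_of_le zero_le_one,
      intervalIntegral.integral_eq_sub_of_hasDerivAt (f := fun t => (-(1/2)) / (1+t)) ?_ hint]
    · norm_num
    · intro t ht
      rw [Set.uIcc_of_le zero_le_one] at ht
      have h : 1 + t ≠ 0 := by linarith [ht.1]
      refine ((hasDerivAt_const t (-(1/2):ℝ)).div ((hasDerivAt_id' t).const_add 1) h).congr_deriv ?_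
      field_simp
      ring

lemma int_all : IntegrableOn (fun t => ff t / (1+t)^2) (Set.Ioi 0) ∧
    ∫ t in Set.Ioi (0:ℝ), ff t / (1+t)^2 = Real.sqrt 2/2 := by
  rw [← Set.Ioc_union_Ioi_eq_Ioi (zero_le_one' ℝ)]
  refine ⟨int_small.1.union int_big.1, ?_⟩
  rw [setIntegral_union (Set.Ioc_disjoint_Ioi le_rfl) measurableSet_Ioi int_small.1 int_big.1,
    int_small.2, int_big.2]
  ring

lemma int_p (c : ℝ) (hc : 0 < c) : IntegrableOn (fun p => p * Real.exp (-(c*p))) (Set.Ioi 0) ∧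
    ∫ p in Set.Ioi (0:ℝ), p * Real.exp (-(c*p)) = 1/c^2 := by
  have h := Real.integral_rpow_mul_exp_neg_mul_Ioi (a := 2) (r := c) (by norm_num) hc
  have e : ∀ p : ℝ, p ^ ((2:ℝ)-1) = p := by intro p; norm_num
  simp only [e] at h
  have h' : ∫ p in Set.Ioi (0:ℝ), p * Real.exp (-(c*p)) = 1/c^2 := by
    rw [h]; simp
  refine ⟨?_, h'⟩
  by_contra hn
  rw [integral_undef hn] at h'
  have : 0 < 1/c^2 := by positivity
  linarith

lemma swap_int (β : ℝ) (hβ : 0 < β) :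
    ∫ p in Set.Ioi (0:ℝ), ∫ t in Set.Ioi (0:ℝ), ff t * (p * Real.exp (-(β*(1+t)*p)))
      = Real.sqrt 2/2/β^2 := by
  have hin : ∀ t ∈ Set.Ioi (0:ℝ), ∫ p in Set.Ioi (0:ℝ), ff t * (p * Real.exp (-(β*(1+t)*p)))
      = (1/β^2) * (ff t / (1+t)^2) := by
    intro t ht
    have ht : 0 < t := ht
    rw [integral_const_mul, (int_p (β*(1+t)) (by positivity)).2]
    field_simp
  rw [integral_integral_swap]
  · rw [setIntegral_congr_fun measurableSet_Ioi hin, integral_const_mul, int_all.2]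
    ring
  · have hm : Measurable (Function.uncurry fun p t : ℝ => ff t * (p * Real.exp (-(β*(1+t)*p)))) := by
      have := ff_meas
      unfold Function.uncurry
      fun_prop
    rw [integrable_prod_iff' hm.aestronglyMeasurable]
    constructor
    · filter_upwards [ae_restrict_mem measurableSet_Ioi] with t ht
      have ht : 0 < t := ht
      exact (int_p (β*(1+t)) (by positivity)).1.const_mul (ff t)
    · refine ((int_all.1.const_mul (1/β^2)).congr ?_)
      filter_upwards [ae_restrict_mem measurableSet_Ioi] with t ht
      rw [← hin t ht]
      refine setIntegral_congr_fun measurableSet_Ioi ?_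
      intro p hp
      have hp : 0 < p := hp
      have := ff_nonneg t
      simp only [Function.uncurry]
      rw [Real.norm_of_nonneg (by positivity)]

/-- The canonical average of the collision rate `F(ε_B, ε_P)` (the zeroth moment
of the energy transfer rate, stripped of the geometric factor) with respect to
the canonical ball-piston energy distribution at inverse temperature `β`. -/
theorem stmt_15 (β : ℝ) (hβ : 0 < β) :
    ∫ p in Set.Ioi (0:ℝ), ∫ a in Set.Ioi (0:ℝ),
        (β ^ ((3:ℝ)/2) / Real.sqrt (Real.pi * p)) * Real.exp (-β*(a + p)) *
          (if p < a then
              (1/Real.pi) * (Real.sqrt (a - p)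
                + Real.sqrt p * Real.arcsin (Real.sqrt (p/a)))
            else (1/2) * Real.sqrt p) =
      1/Real.sqrt (2*Real.pi*β) := by
  have key : ∀ p ∈ Set.Ioi (0:ℝ), (∫ a in Set.Ioi (0:ℝ),
        (β ^ ((3:ℝ)/2) / Real.sqrt (Real.pi * p)) * Real.exp (-β*(a + p)) *
          (if p < a then
              (1/Real.pi) * (Real.sqrt (a - p)
                + Real.sqrt p * Real.arcsin (Real.sqrt (p/a)))
            else (1/2) * Real.sqrt p)) =
      (β ^ ((3:ℝ)/2) / Real.sqrt Real.pi) *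
        ∫ t in Set.Ioi (0:ℝ), ff t * (p * Real.exp (-(β*(1+t)*p))) := by
    intro p hp
    have hp : 0 < p := hp
    have h := integral_comp_mul_left_Ioi (fun a =>
        (β ^ ((3:ℝ)/2) / Real.sqrt (Real.pi * p)) * Real.exp (-β*(a + p)) *
          (if p < a then
              (1/Real.pi) * (Real.sqrt (a - p)
                + Real.sqrt p * Real.arcsin (Real.sqrt (p/a)))
            else (1/2) * Real.sqrt p)) 0 hp
    rw [mul_zero, smul_eq_mul, eq_inv_mul_iff_mul_eq₀ hp.ne'] at h
    rw [← h, ← integral_const_mul, ← integral_const_mul]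
    refine setIntegral_congr_fun measurableSet_Ioi ?_
    intro t ht
    have ht : 0 < t := ht
    have hF : (if p < p*t then
              (1/Real.pi) * (Real.sqrt (p*t - p)
                + Real.sqrt p * Real.arcsin (Real.sqrt (p/(p*t))))
            else (1/2) * Real.sqrt p) = Real.sqrt p * ff t := by
      have e1 : p < p*t ↔ 1 < t := by
        constructor <;> intro h <;> nlinarith
      have e2 : p*t - p = p*(t-1) := by ring
      have e3 : p/(p*t) = 1/t := by field_simp
      simp only [ff, e1, e2, e3, Real.sqrt_mul hp.le]
      split_ifs <;> ring
    have he : -β*(p*t+p) = -(β*(1+t)*p) := by ring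
    simp only [hF, he, Real.sqrt_mul Real.pi_pos.le]
    have := Real.sqrt_pos.2 hp
    field_simp
  rw [setIntegral_congr_fun measurableSet_Ioi key, integral_const_mul, swap_int β hβ]
  have e32 : β ^ ((3:ℝ)/2) = β * Real.sqrt β := by
    rw [Real.sqrt_eq_rpow, show (3:ℝ)/2 = 1 + 1/2 by norm_num, Real.rpow_add hβ, Real.rpow_one]
  rw [e32, Real.sqrt_mul (by positivity), Real.sqrt_mul (by norm_num)]
  have h1 := Real.sqrt_pos.2 hβ
  have h2 := Real.sqrt_pos.2 Real.pi_pos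
  have h3 := Real.sq_sqrt hβ.le
  have h4 : Real.sqrt 2 ^ 2 = 2 := Real.sq_sqrt (by norm_num)
  field_simp
  rw [h3, h4]
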